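/- arXiv:1201.6307 — 5 statements merged into one kernel-verified Lean document; each statement's English description precedes it below -/
import Mathlib

section
/- Let (τ_n) and (k_n) be sequences of positive reals such that n² τ_n² / k_n → 0 as n → ∞. Define B_n = { x ∈ ℝⁿ : |x_i| ≤ τ_n √(n/k_n) for i = 1, …, n and |Σ_{i=1}^n x_i| ≤ τ_n √(n/k_n) }. Then sup_{x ∈ B_n} |1 − Π_{i=1}^n (1 + x_i)| → 0 as n → ∞. -/
open Filter

lemma exp_sub_two_mul_sq_le_one_add {x : ℝ} (hx : |x| ≤ 1 / 2) :
    Real.exp (x - 2 * x ^ 2) ≤ 1 + x := by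
  have h1 : (1 : ℝ) / 2 ≤ 1 + x := by linarith [(abs_le.1 hx).1]
  have hpos : 0 < 1 + x := by linarith
  rw [← Real.le_log_iff_exp_le hpos]
  refine le_trans ?_ (Real.one_sub_inv_le_log_of_pos hpos)
  have h2 : 1 - (1 + x)⁻¹ - (x - 2 * x ^ 2) = x ^ 2 * (1 + 2 * x) / (1 + x) := by
    field_simp
    ring
  have h3 : 0 ≤ x ^ 2 * (1 + 2 * x) / (1 + x) :=
    div_nonneg (mul_nonneg (sq_nonneg x) (by linarith)) hpos.le
  linarith

lemma abs_one_sub_prod_one_add_le {ι : Type*} [Fintype ι] {x : ι → ℝ} {δ : ℝ}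
    (hδ : δ ≤ 1 / 2) (hx : ∀ i, |x i| ≤ δ) (hsum : |∑ i, x i| ≤ δ) :
    |1 - ∏ i, (1 + x i)| ≤ Real.exp (δ + 2 * (Fintype.card ι * δ ^ 2)) - 1 := by
  set a := δ + 2 * (Fintype.card ι * δ ^ 2) with ha
  have hxi : ∀ i, |x i| ≤ 1 / 2 := fun i => (hx i).trans hδ
  have hsq : ∑ i, x i ^ 2 ≤ Fintype.card ι * δ ^ 2 := by
    have h : ∑ i, x i ^ 2 ≤ ∑ _i : ι, δ ^ 2 :=
      Finset.sum_le_sum fun i _ => sq_le_sq' (abs_le.1 (hx i)).1 (abs_le.1 (hx i)).2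
    simpa using h
  have hupper : ∏ i, (1 + x i) ≤ Real.exp a := by
    calc ∏ i, (1 + x i) ≤ ∏ i, Real.exp (x i) :=
          Finset.prod_le_prod (fun i _ => by linarith [(abs_le.1 (hxi i)).1])
            fun i _ => by linarith [Real.add_one_le_exp (x i)]
      _ = Real.exp (∑ i, x i) := (Real.exp_sum _ _).symm
      _ ≤ Real.exp a := by
          have : 0 ≤ (Fintype.card ι : ℝ) * δ ^ 2 := by positivity
          exact Real.exp_le_exp.2 (by linarith [(abs_le.1 hsum).2])
  have hlower : Real.exp (-a) ≤ ∏ i, (1 + x i) := by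
    calc Real.exp (-a) ≤ Real.exp (∑ i, (x i - 2 * x i ^ 2)) := by
          rw [Finset.sum_sub_distrib, ← Finset.mul_sum]
          exact Real.exp_le_exp.2 (by linarith [(abs_le.1 hsum).1])
      _ = ∏ i, Real.exp (x i - 2 * x i ^ 2) := Real.exp_sum _ _
      _ ≤ ∏ i, (1 + x i) :=
          Finset.prod_le_prod (fun i _ => (Real.exp_pos _).le)
            fun i _ => exp_sub_two_mul_sq_le_one_add (hxi i)
  rw [abs_le]
  constructor
  · linarith
  · linarith [Real.add_one_le_exp a, Real.add_one_le_exp (-a)]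

/-- Let `(τ_n)` and `(k_n)` be sequences of positive reals such that
`n² τ_n² / k_n → 0` as `n → ∞`. Define
`B_n = { x ∈ ℝⁿ : |x_i| ≤ τ_n √(n/k_n) for all i and |∑ x_i| ≤ τ_n √(n/k_n) }`.
Then `sup_{x ∈ B_n} |1 − ∏ᵢ (1 + x_i)| → 0` as `n → ∞`. -/
theorem sup_abs_one_sub_prod_tendsto_zero
    (τ k : ℕ → ℝ) (hτ : ∀ n, 0 < τ n) (hk : ∀ n, 0 < k n)
    (hlim : Tendsto (fun n : ℕ => (n : ℝ) ^ 2 * (τ n) ^ 2 / k n) atTop (nhds 0)) :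
    Tendsto
      (fun n : ℕ =>
        ⨆ x : {x : Fin n → ℝ //
            (∀ i, |x i| ≤ τ n * Real.sqrt ((n : ℝ) / k n)) ∧
            |∑ i, x i| ≤ τ n * Real.sqrt ((n : ℝ) / k n)},
          |1 - ∏ i, (1 + x.1 i)|)
      atTop (nhds 0) := by
  set δ : ℕ → ℝ := fun n => τ n * Real.sqrt ((n : ℝ) / k n) with hδ
  have hδ0 : ∀ n, 0 ≤ δ n := fun n => mul_nonneg (hτ n).le (Real.sqrt_nonneg _)
  have hsq : ∀ n, δ n ^ 2 = τ n ^ 2 * (n / k n) := fun n => by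
    simp only [hδ]
    rw [mul_pow, Real.sq_sqrt (div_nonneg n.cast_nonneg (hk n).le)]
  have hnδ : Tendsto (fun n : ℕ => (n : ℝ) * δ n ^ 2) atTop (nhds 0) := by
    refine hlim.congr fun n => ?_
    rw [hsq]
    ring
  have hδlim : Tendsto δ atTop (nhds 0) := by
    have hδsq : Tendsto (fun n => δ n ^ 2) atTop (nhds 0) := by
      refine squeeze_zero' (.of_forall fun n => sq_nonneg _) ?_ hnδ
      filter_upwards [eventually_ge_atTop 1] with n hn
      exact le_mul_of_one_le_left (sq_nonneg _) (by exact_mod_cast hn)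
    simpa [Real.sqrt_sq (hδ0 _)] using hδsq.sqrt
  have hbound : Tendsto (fun n : ℕ => Real.exp (δ n + 2 * (n * δ n ^ 2)) - 1) atTop (nhds 0) := by
    have h := ((Real.continuous_exp.tendsto _).comp (hδlim.add (hnδ.const_mul 2))).sub_const 1
    simpa [Function.comp_def] using h
  refine squeeze_zero' (.of_forall fun n => Real.iSup_nonneg fun x => abs_nonneg _) ?_ hbound
  filter_upwards [hδlim.eventually (ge_mem_nhds (by norm_num : (0 : ℝ) < 1 / 2))] with n hn
  refine Real.iSup_le (fun x => ?_) ?_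
  · simpa using abs_one_sub_prod_one_add_le hn x.2.1 x.2.2
  · have h0 := hδ0 n
    exact sub_nonneg.2 (Real.one_le_exp (by positivity))
end

section
/- Let n be a positive integer and x₁, …, x_n real numbers with |x_i| ≤ 1/2 for every i. Then |Π_{i=1}^n (1 + x_i) − 1| ≤ exp(|Σ_{i=1}^n x_i| + Σ_{i=1}^n x_i²) − 1. -/
theorem exp_sub_sq_le_one_add {x : ℝ} (hx : |x| ≤ 1 / 2) :
    Real.exp (x - x ^ 2) ≤ 1 + x := by
  obtain ⟨hl, hu⟩ := abs_le.mp hx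
  rcases le_total 0 x with h | h
  · rw [← Real.le_log_iff_exp_le (by linarith)]
    refine le_trans ?_ (Real.le_log_one_add_of_nonneg h)
    rw [le_div_iff₀ (by linarith)]
    nlinarith [mul_nonneg h h, mul_nonneg h (mul_nonneg h h)]
  · obtain ⟨t, rfl⟩ : ∃ t, x = -t := ⟨-x, by ring⟩
    have ht : 0 ≤ t := by linarith
    have hq := Real.quadratic_le_exp_of_nonneg (x := t + t ^ 2) (by positivity)
    have hpoly : 0 ≤ t ^ 2 * (1 - t - t ^ 2 - t ^ 3) := by
      have h2 : t ^ 2 ≤ (1 / 2) ^ 2 := by gcongr; linarith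
      have h3 : t ^ 3 ≤ (1 / 2) ^ 3 := by gcongr; linarith
      exact mul_nonneg (sq_nonneg t) (by linarith)
    have hmul := mul_le_mul_of_nonneg_left hq (show 0 ≤ 1 - t by linarith)
    rw [show -t - (-t) ^ 2 = -(t + t ^ 2) by ring, Real.exp_neg,
      inv_le_iff_one_le_mul₀ (Real.exp_pos _)]
    linarith

theorem abs_sub_one_le_exp_sub_one {p a : ℝ} (hl : Real.exp (-a) ≤ p) (hu : p ≤ Real.exp a) :
    |p - 1| ≤ Real.exp a - 1 := by
  rw [abs_le]
  constructor <;> linarith [Real.add_one_le_exp a, Real.add_one_le_exp (-a)]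

/-- Let `n` be a positive integer and `x₁, …, xₙ` real numbers with
`|xᵢ| ≤ 1/2` for every `i`. Then
`|∏ᵢ (1 + xᵢ) − 1| ≤ exp(|∑ᵢ xᵢ| + ∑ᵢ xᵢ²) − 1`. -/
theorem abs_prod_one_add_sub_one_le
    (n : ℕ) (hn : 0 < n) (x : Fin n → ℝ) (hx : ∀ i, |x i| ≤ 1 / 2) :
    |(∏ i, (1 + x i)) - 1| ≤ Real.exp (|∑ i, x i| + ∑ i, (x i) ^ 2) - 1 := by
  have hQ : 0 ≤ ∑ i, (x i) ^ 2 := Finset.sum_nonneg fun i _ => sq_nonneg (x i)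
  apply abs_sub_one_le_exp_sub_one
  · calc Real.exp (-(|∑ i, x i| + ∑ i, (x i) ^ 2))
        ≤ Real.exp (∑ i, (x i - (x i) ^ 2)) := by
          rw [Real.exp_le_exp, Finset.sum_sub_distrib]
          linarith [neg_abs_le (∑ i, x i)]
      _ = ∏ i, Real.exp (x i - (x i) ^ 2) := Real.exp_sum _ _
      _ ≤ ∏ i, (1 + x i) :=
          Finset.prod_le_prod (fun i _ => (Real.exp_pos _).le)
            fun i _ => exp_sub_sq_le_one_add (hx i)
  · calc ∏ i, (1 + x i) ≤ ∏ i, Real.exp (x i) :=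
          Finset.prod_le_prod (fun i _ => by linarith [(abs_le.mp (hx i)).1])
            fun i _ => by linarith [Real.add_one_le_exp (x i)]
      _ = Real.exp (∑ i, x i) := (Real.exp_sum _ _).symm
      _ ≤ Real.exp (|∑ i, x i| + ∑ i, (x i) ^ 2) := by
          rw [Real.exp_le_exp]
          linarith [le_abs_self (∑ i, x i)]
end

section
/- For all t > 0 and x, y ∈ ℝ, ∫₀^t ∫_ℝ p(u, x, ξ) · (∂³/∂ξ³) p(t − u, ξ, y) dξ du = −t · ∂³p/∂y³(t, x, y) = t^{−1/2} (w³ − 3w) p(t, x, y), where w = (y − x − t)/√t. (This identifies, up to the factor μ₃/6, the first Edgeworth correction term π₁ = p ⊗ 𝔉₁[p] in the constant-coefficient case.) -/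
open Real MeasureTheory intervalIntegral

/-- The transition density of the unit-drift Brownian motion `Y_s = Y_0 + s + W_s`:
`p(t, x, y) = (2π t)^{−1/2} exp(−(y − x − t)²/(2t))`. -/
noncomputable def driftKernel (t x y : ℝ) : ℝ :=
  (2 * Real.pi * t) ^ (-(1 : ℝ) / 2) * Real.exp (-(y - x - t) ^ 2 / (2 * t))

theorem driftKernel_eq (t x y : ℝ) (ht : 0 < t) :
    driftKernel t x y = (√(2 * π * t))⁻¹ * exp (-(y - x - t) ^ 2 / (2 * t)) := by
  have h : (0 : ℝ) ≤ 2 * π * t := by positivity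
  rw [driftKernel, neg_div, rpow_neg h, sqrt_eq_rpow]

theorem iteratedDeriv_three_gaussian (s c k d z : ℝ) (hs : s ≠ 0) :
    iteratedDeriv 3 (fun z => c * exp (-(k * z + d) ^ 2 / (2 * s))) z =
      -k ^ 3 * ((k * z + d) ^ 3 / s ^ 3 - 3 * (k * z + d) / s ^ 2) *
        (c * exp (-(k * z + d) ^ 2 / (2 * s))) := by
  have hlin (z : ℝ) : HasDerivAt (fun z => k * z + d) k z := by
    simpa using ((hasDerivAt_id z).const_mul k).add_const d
  have hexp (z : ℝ) : HasDerivAt (fun z => c * exp (-(k * z + d) ^ 2 / (2 * s)))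
      (-k * ((k * z + d) / s) * (c * exp (-(k * z + d) ^ 2 / (2 * s)))) z := by
    refine (((((hlin z).fun_pow 2).fun_neg.div_const (2 * s)).exp).const_mul c).congr_deriv ?_
    simp only [Nat.cast_ofNat]
    field_simp
    ring
  have h1 : deriv (fun z => c * exp (-(k * z + d) ^ 2 / (2 * s))) =
      fun z => (-k * ((k * z + d) / s)) * (c * exp (-(k * z + d) ^ 2 / (2 * s))) :=
    funext fun z => (hexp z).deriv
  have h2 : deriv (fun z => (-k * ((k * z + d) / s)) *
        (c * exp (-(k * z + d) ^ 2 / (2 * s)))) =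
      fun z => (k ^ 2 * ((k * z + d) ^ 2 / s ^ 2 - 1 / s)) *
        (c * exp (-(k * z + d) ^ 2 / (2 * s))) := by
    funext z
    rw [((((hlin z).div_const s).const_mul (-k)).fun_mul (hexp z)).deriv]
    field_simp
    ring
  rw [iteratedDeriv_succ, iteratedDeriv_succ, iteratedDeriv_one, h1, h2,
    ((((((hlin z).fun_pow 2).div_const (s ^ 2)).sub_const (1 / s)).const_mul (k ^ 2)).fun_mul
      (hexp z)).deriv]
  simp only [Nat.cast_ofNat]
  field_simp
  ring

theorem integrable_pow_mul_exp_neg_mul_sq {b : ℝ} (hb : 0 < b) (n : ℕ) :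
    Integrable fun z : ℝ => z ^ n * exp (-b * z ^ 2) := by
  have h : (-1 : ℝ) < n := by linarith [n.cast_nonneg (α := ℝ)]
  simpa using integrable_rpow_mul_exp_neg_mul_sq hb h

theorem integral_cubic_mul_exp_neg_mul_sq {b : ℝ} (hb : 0 < b) (c₀ c₁ c₂ c₃ : ℝ) :
    ∫ z : ℝ, (c₀ + c₁ * z + c₂ * z ^ 2 + c₃ * z ^ 3) * exp (-b * z ^ 2) =
      (c₀ + c₂ / (2 * b)) * √(π / b) := by
  have hpow_int := integrable_pow_mul_exp_neg_mul_sq hb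
  have h0 := integrable_exp_neg_mul_sq hb
  set q : ℝ → ℝ := fun z => -(c₁ / (2 * b) + c₃ / (2 * b ^ 2)) - c₂ / (2 * b) * z -
    c₃ / (2 * b) * z ^ 2 with hq
  have hderiv (z : ℝ) : HasDerivAt (fun z => q z * exp (-b * z ^ 2))
      ((c₁ * z + c₂ * z ^ 2 + c₃ * z ^ 3 - c₂ / (2 * b)) * exp (-b * z ^ 2)) z := by
    have hq' : HasDerivAt q (-(c₂ / (2 * b)) - c₃ / (2 * b) * (2 * z)) z :=
      ((((hasDerivAt_id' z).const_mul (c₂ / (2 * b))).const_sub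
        (-(c₁ / (2 * b) + c₃ / (2 * b ^ 2)))).fun_sub
        (((hasDerivAt_id' z).fun_pow 2).const_mul (c₃ / (2 * b)))).congr_deriv (by simp)
    refine (hq'.fun_mul (((hasDerivAt_id' z).fun_pow 2).const_mul (-b)).exp).congr_deriv ?_
    simp only [hq, Nat.cast_ofNat]
    field_simp
    ring
  have hzero := integral_eq_zero_of_hasDerivAt_of_integrable hderiv
    ((((hpow_int 1).const_mul c₁).add ((hpow_int 2).const_mul c₂)).add ((hpow_int 3).const_mul c₃) |>.sub
      (h0.const_mul (c₂ / (2 * b))) |>.congr (.of_forall fun z => by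
        simp only [Pi.add_apply, Pi.sub_apply]; ring))
    ((h0.const_mul (-(c₁ / (2 * b) + c₃ / (2 * b ^ 2)))).sub ((hpow_int 1).const_mul (c₂ / (2 * b)))
      |>.sub ((hpow_int 2).const_mul (c₃ / (2 * b))) |>.congr (.of_forall fun z => by
        simp only [Pi.sub_apply, hq]; ring))
  have hsplit : ∀ z : ℝ, (c₀ + c₁ * z + c₂ * z ^ 2 + c₃ * z ^ 3) * exp (-b * z ^ 2) =
      (c₁ * z + c₂ * z ^ 2 + c₃ * z ^ 3 - c₂ / (2 * b)) * exp (-b * z ^ 2) +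
        (c₀ + c₂ / (2 * b)) * exp (-b * z ^ 2) := fun z => by ring
  simp_rw [hsplit]
  rw [integral_add _ (h0.const_mul _), hzero, MeasureTheory.integral_const_mul, integral_gaussian,
    zero_add]
  exact (((hpow_int 1).const_mul c₁).add ((hpow_int 2).const_mul c₂)).add ((hpow_int 3).const_mul c₃) |>.sub
      (h0.const_mul (c₂ / (2 * b))) |>.congr (.of_forall fun z => by
        simp only [Pi.add_apply, Pi.sub_apply]; ring)

theorem iteratedDeriv_three_driftKernel_start (s y ξ : ℝ) (hs : 0 < s) :
    iteratedDeriv 3 (fun z => driftKernel s z y) ξ =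
      ((y - ξ - s) ^ 3 / s ^ 3 - 3 * (y - ξ - s) / s ^ 2) * driftKernel s ξ y := by
  have h := iteratedDeriv_three_gaussian s (√(2 * π * s))⁻¹ (-1) (y - s) ξ hs.ne'
  have hlin (z : ℝ) : -1 * z + (y - s) = y - z - s := by ring
  simp only [hlin] at h
  simp only [driftKernel_eq s _ _ hs, h]
  ring

theorem iteratedDeriv_three_driftKernel_end (t x y : ℝ) (ht : 0 < t) :
    iteratedDeriv 3 (fun z => driftKernel t x z) y =
      -((y - x - t) ^ 3 / t ^ 3 - 3 * (y - x - t) / t ^ 2) * driftKernel t x y := by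
  have h := iteratedDeriv_three_gaussian t (√(2 * π * t))⁻¹ 1 (-x - t) y ht.ne'
  have hlin (z : ℝ) : 1 * z + (-x - t) = z - x - t := by ring
  simp only [hlin] at h
  simp only [driftKernel_eq t _ _ ht, h]
  ring

theorem integral_driftKernel_mul_iteratedDeriv_three (u s x y : ℝ) (hu : 0 < u) (hs : 0 < s) :
    ∫ ξ : ℝ, driftKernel u x ξ * iteratedDeriv 3 (fun z => driftKernel s z y) ξ =
      ((y - x - (u + s)) ^ 3 / (u + s) ^ 3 - 3 * (y - x - (u + s)) / (u + s) ^ 2) *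
        driftKernel (u + s) x y := by
  have hut : 0 < u + s := add_pos hu hs
  obtain ⟨a, ha⟩ : ∃ a, a = y - x - (u + s) := ⟨_, rfl⟩
  obtain rfl : y = a + x + (u + s) := by linarith
  set b : ℝ := (u + s) / (2 * u * s) with hb
  have hb0 : 0 < b := by positivity
  set r : ℝ := s / (u + s) * a with hr
  set C : ℝ := (√(2 * π * u))⁻¹ * (√(2 * π * s))⁻¹ * exp (-a ^ 2 / (2 * (u + s))) with hC
  rw [← integral_add_right_eq_self _ (x + u + u / (u + s) * a)]
  have hintegrand (η : ℝ) :
      driftKernel u x (η + (x + u + u / (u + s) * a)) *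
        iteratedDeriv 3 (fun z => driftKernel s z (a + x + (u + s)))
          (η + (x + u + u / (u + s) * a)) =
      C * (((r ^ 3 / s ^ 3 - 3 * r / s ^ 2) + (-3 * r ^ 2 / s ^ 3 + 3 / s ^ 2) * η +
        (3 * r / s ^ 3) * η ^ 2 + (-1 / s ^ 3) * η ^ 3) * exp (-b * η ^ 2)) := by
    rw [iteratedDeriv_three_driftKernel_start _ _ _ hs, driftKernel_eq _ _ _ hu,
      driftKernel_eq _ _ _ hs]
    have hz : a + x + (u + s) - (η + (x + u + u / (u + s) * a)) - s = r - η := by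
      rw [hr]; field_simp; ring
    have hexp : exp (-(η + (x + u + u / (u + s) * a) - x - u) ^ 2 / (2 * u)) *
        exp (-(r - η) ^ 2 / (2 * s)) =
        exp (-a ^ 2 / (2 * (u + s))) * exp (-b * η ^ 2) := by
      rw [← exp_add, ← exp_add, hr, hb]
      congr 1
      field_simp
      ring
    rw [hz, hC]
    linear_combination ((√(2 * π * u))⁻¹ * (√(2 * π * s))⁻¹ *
      ((r - η) ^ 3 / s ^ 3 - 3 * (r - η) / s ^ 2)) * hexp
  have hsqrt : (√(2 * π * u))⁻¹ * (√(2 * π * s))⁻¹ * √(π / b) = (√(2 * π * (u + s)))⁻¹ := by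
    rw [← sqrt_inv, ← sqrt_inv, ← sqrt_inv, ← sqrt_mul (by positivity),
      ← sqrt_mul (by positivity), hb]
    congr 1
    field_simp
  have hcoef : r ^ 3 / s ^ 3 - 3 * r / s ^ 2 + 3 * r / s ^ 3 / (2 * b) =
      a ^ 3 / (u + s) ^ 3 - 3 * a / (u + s) ^ 2 := by
    rw [hr, hb]
    field_simp
    ring
  simp_rw [hintegrand]
  rw [MeasureTheory.integral_const_mul, integral_cubic_mul_exp_neg_mul_sq hb0, hcoef, ← ha,
    driftKernel_eq _ _ _ hut, ← ha, ← hsqrt, hC]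
  ring

/-- For all `t > 0` and `x, y ∈ ℝ`,
`∫₀^t ∫_ℝ p(u,x,ξ) ∂³/∂ξ³ p(t−u,ξ,y) dξ du = −t ∂³p/∂y³(t,x,y)
  = t^{−1/2}(w³ − 3w) p(t,x,y)`, where `w = (y − x − t)/√t`. -/
theorem driftKernel_pi_one
    (t x y : ℝ) (ht : 0 < t) :
    (∫ u in (0 : ℝ)..t, ∫ ξ : ℝ,
        driftKernel u x ξ * iteratedDeriv 3 (fun z => driftKernel (t - u) z y) ξ) =
        -t * iteratedDeriv 3 (fun y' => driftKernel t x y') y ∧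
    -t * iteratedDeriv 3 (fun y' => driftKernel t x y') y =
        t ^ (-(1 : ℝ) / 2) *
          (((y - x - t) / Real.sqrt t) ^ 3 - 3 * ((y - x - t) / Real.sqrt t)) *
          driftKernel t x y := by
  rw [iteratedDeriv_three_driftKernel_end t x y ht]
  constructor
  · rw [integral_of_le ht.le, integral_Ioc_eq_integral_Ioo,
      setIntegral_congr_fun (g := fun _ => ((y - x - t) ^ 3 / t ^ 3 - 3 * (y - x - t) / t ^ 2) *
        driftKernel t x y) measurableSet_Ioo fun u hu => ?_]
    · simp only [setIntegral_const, measureReal_def, Real.volume_Ioo, smul_eq_mul, sub_zero,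
        ENNReal.toReal_ofReal ht.le]
      ring
    · have h := integral_driftKernel_mul_iteratedDeriv_three u (t - u) x y hu.1 (sub_pos.2 hu.2)
      simpa only [add_sub_cancel] using h
  · have hsq : √t ^ 2 = t := sq_sqrt ht.le
    have hpos : 0 < √t := sqrt_pos.2 ht
    rw [neg_div, rpow_neg ht.le, ← sqrt_eq_rpow]
    generalize driftKernel t x y = p
    generalize y - x - t = a
    generalize √t = w at hsq hpos
    subst hsq
    field_simp
end

section
/- For every c > 0 there exists a constant C < ∞ such that for all 0 < t ≤ c and all x, y ∈ ℝ: |∂p̂/∂x(t, x, y)| ≤ C (p̂(t, x, y)/√t) (√t + |S(y) − S(x)|/√t) and |∂p̂/∂y(t, x, y)| ≤ C (p̂(t, x, y)/√t) (√t + |S(y) − S(x)|/√t). -/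
open Real MeasureTheory intervalIntegral

/-- `S(x) = ∫₀^x σ(u)⁻¹ du`. -/
noncomputable def Sfun (σ : ℝ → ℝ) (x : ℝ) : ℝ := ∫ u in (0 : ℝ)..x, (σ u)⁻¹

/-- `C(u) = m(u)/σ(u) − σ′(u)/2`. -/
noncomputable def Cfun (m σ : ℝ → ℝ) (u : ℝ) : ℝ := m u / σ u - deriv σ u / 2

/-- `H(x) = ∫₀^{S(x)} C(u) du`. -/
noncomputable def Hfun (m σ : ℝ → ℝ) (x : ℝ) : ℝ := ∫ u in (0 : ℝ)..(Sfun σ x), Cfun m σ u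

/-- `p̂(t, x, y) = (2π t)^{−1/2} σ(y)⁻¹ exp(−(S(y) − S(x))²/(2t) + H(y) − H(x))`. -/
noncomputable def phat (m σ : ℝ → ℝ) (t x y : ℝ) : ℝ :=
  (2 * Real.pi * t) ^ (-(1 : ℝ) / 2) * (σ y)⁻¹ *
    Real.exp (-(Sfun σ y - Sfun σ x) ^ 2 / (2 * t) + Hfun m σ y - Hfun m σ x)

theorem hasDerivAt_Sfun {σ : ℝ → ℝ} (hσ : Continuous σ) (hpos : ∀ x, 0 < σ x) (x : ℝ) :
    HasDerivAt (Sfun σ) (σ x)⁻¹ x := by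
  have hc : Continuous fun u => (σ u)⁻¹ := hσ.inv₀ fun u => (hpos u).ne'
  exact hc.integral_hasStrictDerivAt 0 x |>.hasDerivAt

theorem hasDerivAt_Hfun {m σ : ℝ → ℝ} (hm : Continuous m) (hσ : ContDiff ℝ 1 σ)
    (hpos : ∀ x, 0 < σ x) (x : ℝ) :
    HasDerivAt (Hfun m σ) (Cfun m σ (Sfun σ x) * (σ x)⁻¹) x := by
  have hc : Continuous (Cfun m σ) :=
    (hm.div hσ.continuous fun u => (hpos u).ne').sub ((hσ.continuous_deriv le_rfl).div_const 2)
  exact (hc.integral_hasStrictDerivAt 0 (Sfun σ x)).hasDerivAt.comp x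
    (hasDerivAt_Sfun hσ.continuous hpos x)

theorem abs_Cfun_le {m σ : ℝ → ℝ} {M l u : ℝ} (hl : 0 < l) (hm : |m u| ≤ M)
    (hσ : l ≤ σ u) (hσ' : |deriv σ u| ≤ M) : |Cfun m σ u| ≤ M / l + M / 2 := by
  have hM : 0 ≤ M := (abs_nonneg _).trans hm
  calc |Cfun m σ u| ≤ |m u / σ u| + |deriv σ u / 2| := abs_sub _ _
    _ = |m u| / σ u + |deriv σ u| / 2 := by
      rw [abs_div, abs_div, abs_of_pos (hl.trans_le hσ), abs_two]
    _ ≤ M / l + M / 2 := by gcongr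

theorem phat_pos {m σ : ℝ → ℝ} (hpos : ∀ x, 0 < σ x) {t : ℝ} (ht : 0 < t) (x y : ℝ) :
    0 < phat m σ t x y := by
  have := hpos y
  unfold phat
  positivity

theorem hasDerivAt_phat_left {m σ : ℝ → ℝ} (hm : Continuous m) (hσ : ContDiff ℝ 1 σ)
    (hpos : ∀ x, 0 < σ x) (t x y : ℝ) :
    HasDerivAt (fun x' => phat m σ t x' y)
      (phat m σ t x y *
        (((Sfun σ y - Sfun σ x) / t - Cfun m σ (Sfun σ x)) * (σ x)⁻¹)) x := by
  have hS := hasDerivAt_Sfun hσ.continuous hpos x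
  have hH := hasDerivAt_Hfun hm hσ hpos x
  have h := (((((hS.const_sub (Sfun σ y)).pow 2).neg.div_const (2 * t)).add_const
    (Hfun m σ y)).sub hH).exp.const_mul ((2 * π * t) ^ (-(1 : ℝ) / 2) * (σ y)⁻¹)
  refine h.congr_deriv ?_
  simp only [phat, Pi.sub_apply, Pi.neg_apply, Pi.pow_apply]
  ring

theorem hasDerivAt_phat_right {m σ : ℝ → ℝ} (hm : Continuous m) (hσ : ContDiff ℝ 1 σ)
    (hpos : ∀ x, 0 < σ x) (t x y : ℝ) :
    HasDerivAt (fun y' => phat m σ t x y')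
      (phat m σ t x y *
        ((-((Sfun σ y - Sfun σ x) / t) + Cfun m σ (Sfun σ y) - deriv σ y) * (σ y)⁻¹)) y := by
  have hS := hasDerivAt_Sfun hσ.continuous hpos y
  have hH := hasDerivAt_Hfun hm hσ hpos y
  have hσy := ((hσ.differentiable one_ne_zero) y).hasDerivAt.inv (hpos y).ne'
  have h := (hσy.const_mul ((2 * π * t) ^ (-(1 : ℝ) / 2))).mul
    ((((((hS.sub_const (Sfun σ x)).pow 2).neg.div_const (2 * t)).add hH).sub_const
      (Hfun m σ x)).exp)
  refine h.congr_deriv ?_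
  simp only [phat, Pi.add_apply, Pi.neg_apply, Pi.pow_apply, Pi.inv_apply]
  ring

theorem abs_mul_mul_inv_le {p a s l d t K : ℝ} (hp : 0 ≤ p) (hl : 0 < l) (hs : l ≤ s)
    (ht : 0 < t) (hK : 0 ≤ K) (ha : |a| ≤ |d| / t + K) :
    |p * (a * s⁻¹)| ≤ (1 + K) / l * (p / √t) * (√t + |d| / √t) := by
  have hR : (1 + K) / l * (p / √t) * (√t + |d| / √t) = p * ((1 + K) * (1 + |d| / t) * l⁻¹) := by
    have hsq : √t ^ 2 = t := Real.sq_sqrt ht.le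
    have h0 : √t ≠ 0 := (Real.sqrt_pos.2 ht).ne'
    rw [← hsq, Real.sqrt_sq (Real.sqrt_nonneg t)]
    field_simp
  rw [hR, abs_mul, abs_mul, abs_of_nonneg hp, abs_inv, abs_of_pos (hl.trans_le hs)]
  have hd : 0 ≤ |d| / t := by positivity
  have hinv : s⁻¹ ≤ l⁻¹ := inv_anti₀ hl hs
  have hinv0 : 0 ≤ s⁻¹ := (inv_pos.2 (hl.trans_le hs)).le
  gcongr
  nlinarith [mul_nonneg hK hd]

/-- For every `c > 0` there exists a constant `C < ∞` such that for all
`0 < t ≤ c` and all `x, y ∈ ℝ`: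
`|∂p̂/∂x(t,x,y)| ≤ C (p̂(t,x,y)/√t)(√t + |S(y) − S(x)|/√t)` and
`|∂p̂/∂y(t,x,y)| ≤ C (p̂(t,x,y)/√t)(√t + |S(y) − S(x)|/√t)`. -/
theorem phat_first_deriv_bounds
    (m σ : ℝ → ℝ) (hm : ContDiff ℝ 2 m) (hσ : ContDiff ℝ 2 σ)
    (M : ℝ)
    (hmbd : ∀ x, |m x| ≤ M ∧ |deriv m x| ≤ M ∧ |iteratedDeriv 2 m x| ≤ M)
    (hσbd : ∀ x, |σ x| ≤ M ∧ |deriv σ x| ≤ M ∧ |iteratedDeriv 2 σ x| ≤ M)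
    (σl σu : ℝ) (hσl : 0 < σl) (hσrange : ∀ x, σl ≤ σ x ∧ σ x ≤ σu)
    (c : ℝ) (hc : 0 < c) :
    ∃ C : ℝ, ∀ t : ℝ, 0 < t → t ≤ c → ∀ x y : ℝ,
      |deriv (fun x' => phat m σ t x' y) x| ≤
          C * (phat m σ t x y / Real.sqrt t) *
            (Real.sqrt t + |Sfun σ y - Sfun σ x| / Real.sqrt t) ∧
      |deriv (fun y' => phat m σ t x y') y| ≤
          C * (phat m σ t x y / Real.sqrt t) *
            (Real.sqrt t + |Sfun σ y - Sfun σ x| / Real.sqrt t) := by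
  have hpos : ∀ x, 0 < σ x := fun x => hσl.trans_le (hσrange x).1
  have hσ1 : ContDiff ℝ 1 σ := hσ.of_le one_le_two
  have hM : 0 ≤ M := (abs_nonneg _).trans (hmbd 0).1
  have hC : ∀ u, |Cfun m σ u| ≤ M / σl + M / 2 := fun u =>
    abs_Cfun_le hσl (hmbd u).1 (hσrange u).1 (hσbd u).2.1
  refine ⟨(1 + (M / σl + M / 2 + M)) / σl, fun t ht _ x y => ?_⟩
  have hd : |(Sfun σ y - Sfun σ x) / t| = |Sfun σ y - Sfun σ x| / t := by
    rw [abs_div, abs_of_pos ht]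
  have hp := (phat_pos (m := m) hpos ht x y).le
  rw [(hasDerivAt_phat_left hm.continuous hσ1 hpos t x y).deriv,
    (hasDerivAt_phat_right hm.continuous hσ1 hpos t x y).deriv]
  constructor
  · refine abs_mul_mul_inv_le hp hσl (hσrange x).1 ht (by positivity) ?_
    refine (abs_sub _ _).trans ?_
    linarith [hC (Sfun σ x)]
  · refine abs_mul_mul_inv_le hp hσl (hσrange y).1 ht (by positivity) ?_
    refine (abs_sub _ _).trans ((add_le_add_left (abs_add_le _ _) _).trans ?_)
    rw [abs_neg]
    linarith [hC (Sfun σ y), (hσbd y).2.1]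
end

section
/- For all nonnegative integers l, m and every c > 0 there exists a constant C < ∞, depending only on l, m and c, such that for all 0 < t ≤ c, all 0 ≤ w < t/4 and all x, y ∈ ℝ: ∫₀^{t/4} u^{−1/2} ∫_ℝ g(u, x, z) (|z − x|/√u)^l g(t − w − u, z, y) (|y − z|/√(t − w − u))^m dz du ≤ C √t · g(t − w, x, y) · (1 + (|y − x|/√(t − w))^{l + m}). -/
open Real MeasureTheory intervalIntegral

/-- The Gaussian heat kernel `g(t, x, y) = (2π t)^{−1/2} exp(−(y − x)²/(2t))`. -/
noncomputable def heatKernel (t x y : ℝ) : ℝ :=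
  (2 * Real.pi * t) ^ (-(1 : ℝ) / 2) * Real.exp (-(y - x) ^ 2 / (2 * t))

theorem heatKernel_eq_inv_sqrt {t : ℝ} (ht : 0 < t) (x y : ℝ) :
    heatKernel t x y = (√(2 * π * t))⁻¹ * rexp (-(y - x) ^ 2 / (2 * t)) := by
  rw [heatKernel, neg_div, Real.rpow_neg (by positivity), Real.sqrt_eq_rpow]

theorem heatKernel_nonneg {t : ℝ} (ht : 0 < t) (x y : ℝ) : 0 ≤ heatKernel t x y := by
  rw [heatKernel_eq_inv_sqrt ht]
  positivity

/-- Scaling of the heat kernel to the standard Gaussian density. -/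
theorem heatKernel_eq_standard {v : ℝ} (hv : 0 < v) (x z : ℝ) :
    heatKernel v x z = (√v)⁻¹ * heatKernel 1 0 ((z - x) / √v) := by
  rw [heatKernel_eq_inv_sqrt hv, heatKernel_eq_inv_sqrt one_pos, mul_one,
    Real.sqrt_mul (by positivity) v, mul_inv, sub_zero, div_pow, Real.sq_sqrt hv.le]
  have : -((z - x) ^ 2 / v) / (2 * 1) = -(z - x) ^ 2 / (2 * v) := by field_simp
  rw [this]
  ring

/-- The product of two heat kernels is a heat kernel times the density of the Brownian bridge. -/
theorem heatKernel_mul_heatKernel {u q : ℝ} (hu : 0 < u) (hq : 0 < q) (x y z : ℝ) :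
    heatKernel u x z * heatKernel q z y =
      heatKernel (u + q) x y *
        heatKernel (u * q / (u + q)) (x + u / (u + q) * (y - x)) z := by
  have hs : 0 < u + q := by positivity
  have hv : 0 < u * q / (u + q) := by positivity
  rw [heatKernel_eq_inv_sqrt hu, heatKernel_eq_inv_sqrt hq, heatKernel_eq_inv_sqrt hs,
    heatKernel_eq_inv_sqrt hv, mul_mul_mul_comm, mul_mul_mul_comm (√(2 * π * (u + q)))⁻¹,
    ← Real.exp_add, ← Real.exp_add, ← mul_inv, ← mul_inv, ← Real.sqrt_mul (by positivity),
    ← Real.sqrt_mul (by positivity)]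
  have hsqrt : 2 * π * u * (2 * π * q) = 2 * π * (u + q) * (2 * π * (u * q / (u + q))) := by
    field_simp
  have hexp : -(z - x) ^ 2 / (2 * u) + -(y - z) ^ 2 / (2 * q) = -(y - x) ^ 2 / (2 * (u + q)) +
      -(z - (x + u / (u + q) * (y - x))) ^ 2 / (2 * (u * q / (u + q))) := by
    field_simp
    ring
  rw [hsqrt, hexp]

theorem integrable_heatKernel_mul_abs_pow (n : ℕ) :
    Integrable fun ζ : ℝ => heatKernel 1 0 ζ * |ζ| ^ n := by
  have h := (integrable_rpow_mul_exp_neg_mul_sq (b := 1 / 2) (by norm_num) (s := n)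
    (by have := n.cast_nonneg (α := ℝ); linarith)).norm.const_mul (√(2 * π * 1))⁻¹
  refine h.congr (ae_of_all _ fun ζ => ?_)
  simp only [Real.rpow_natCast, norm_mul, norm_pow, Real.norm_eq_abs, Real.abs_exp]
  rw [heatKernel_eq_inv_sqrt one_pos,
    show -(1 / 2) * ζ ^ 2 = -(ζ - 0) ^ 2 / (2 * 1) by ring]
  ring

/-- The rescaled increments of a path through `z` from `x` to `y` are dominated by the rescaled
deviation of `z` from the mean of the Brownian bridge plus the rescaled total increment. -/
theorem abs_sub_div_sqrt_le {u q : ℝ} (hu : 0 < u) (hq : 0 < q) (x y z : ℝ) :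
    |z - x| / √u ≤ |(z - (x + u / (u + q) * (y - x))) / √(u * q / (u + q))| +
      |y - x| / √(u + q) := by
  have hs : 0 < u + q := by positivity
  have hv : 0 < u * q / (u + q) := by positivity
  set μ := x + u / (u + q) * (y - x) with hμ
  have h1 : |z - x| ≤ |z - μ| + u / (u + q) * |y - x| := by
    have := abs_add_le (z - μ) (u / (u + q) * (y - x))
    rw [abs_mul, abs_of_pos (by positivity : 0 < u / (u + q))] at this
    rwa [show z - μ + u / (u + q) * (y - x) = z - x by rw [hμ]; ring] at this
  have h2 : √(u * q / (u + q)) ≤ √u := by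
    apply Real.sqrt_le_sqrt
    rw [div_le_iff₀ hs]
    nlinarith
  have h3 : √u ≤ √(u + q) := Real.sqrt_le_sqrt (by linarith)
  have hu' := Real.sqrt_pos.2 hu
  have hs' := Real.sqrt_pos.2 hs
  have hv' := Real.sqrt_pos.2 hv
  have h4 : u / (u + q) / √u ≤ 1 / √(u + q) := by
    rw [div_div, div_le_div_iff₀ (by positivity) hs']
    nlinarith [Real.sq_sqrt hu.le, Real.sq_sqrt hs.le, mul_pos hu' hs',
      mul_le_mul_of_nonneg_left h3 (mul_pos hu' hs').le]
  calc |z - x| / √u ≤ (|z - μ| + u / (u + q) * |y - x|) / √u := by gcongr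
    _ = |z - μ| / √u + u / (u + q) / √u * |y - x| := by ring
    _ ≤ |z - μ| / √(u * q / (u + q)) + 1 / √(u + q) * |y - x| := by gcongr
    _ = _ := by rw [abs_div, abs_of_pos hv']; ring

/-- A constant for which the spatial integral of two heat kernels, weighted by powers of total
degree `n` of the rescaled increments, is controlled. -/
noncomputable def bridgeMomentConst (n : ℕ) : ℝ :=
  2 ^ (n - 1) * ((∫ ζ, heatKernel 1 0 ζ * |ζ| ^ n) + ∫ ζ, heatKernel 1 0 ζ)

theorem integral_heatKernel_mul_pow_le (l m : ℕ) {u q : ℝ} (hu : 0 < u) (hq : 0 < q) (x y : ℝ) :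
    ∫ z : ℝ, heatKernel u x z * (|z - x| / √u) ^ l *
        (heatKernel q z y * (|y - z| / √q) ^ m) ≤
      bridgeMomentConst (l + m) * heatKernel (u + q) x y *
        (1 + (|y - x| / √(u + q)) ^ (l + m)) := by
  have hs : 0 < u + q := by positivity
  have hv : 0 < u * q / (u + q) := by positivity
  have hv' := Real.sqrt_pos.2 hv
  set μ := x + u / (u + q) * (y - x) with hμ
  set σ := √(u * q / (u + q)) with hσ
  set r := |y - x| / √(u + q) with hr
  have hr0 : 0 ≤ r := by positivity
  have hK : ∀ ζ, 0 ≤ heatKernel 1 0 ζ := heatKernel_nonneg one_pos 0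
  have hint := integrable_heatKernel_mul_abs_pow (l + m)
  have hint0 : Integrable fun ζ : ℝ => heatKernel 1 0 ζ := by
    simpa using integrable_heatKernel_mul_abs_pow 0
  set H : ℝ → ℝ := fun ζ =>
    2 ^ (l + m - 1) * (heatKernel 1 0 ζ * |ζ| ^ (l + m) + heatKernel 1 0 ζ * r ^ (l + m)) with hH
  have hHint : Integrable H := (hint.add (hint0.mul_const _)).const_mul _
  have hle : ∀ z, heatKernel u x z * (|z - x| / √u) ^ l *
      (heatKernel q z y * (|y - z| / √q) ^ m) ≤
      heatKernel (u + q) x y * σ⁻¹ * H ((z - μ) / σ) := by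
    intro z
    have h1 := abs_sub_div_sqrt_le hu hq x y z
    have h2 : |y - z| / √q ≤ |(z - μ) / σ| + r := by
      have := abs_sub_div_sqrt_le hq hu y x z
      rw [add_comm q u, mul_comm q u, abs_sub_comm z y, abs_sub_comm x y] at this
      convert this using 5
      rw [hμ]; field_simp; ring
    have h3 : (|z - x| / √u) ^ l * (|y - z| / √q) ^ m ≤
        2 ^ (l + m - 1) * (|(z - μ) / σ| ^ (l + m) + r ^ (l + m)) := by
      calc _ ≤ (|(z - μ) / σ| + r) ^ l * (|(z - μ) / σ| + r) ^ m := by gcongr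
        _ = (|(z - μ) / σ| + r) ^ (l + m) := (pow_add _ _ _).symm
        _ ≤ _ := add_pow_le (abs_nonneg _) hr0 _
    calc _ = heatKernel u x z * heatKernel q z y *
          ((|z - x| / √u) ^ l * (|y - z| / √q) ^ m) := by ring
      _ = heatKernel (u + q) x y * (σ⁻¹ * heatKernel 1 0 ((z - μ) / σ)) *
          ((|z - x| / √u) ^ l * (|y - z| / √q) ^ m) := by
        rw [heatKernel_mul_heatKernel hu hq, heatKernel_eq_standard hv]
      _ ≤ heatKernel (u + q) x y * (σ⁻¹ * heatKernel 1 0 ((z - μ) / σ)) *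
          (2 ^ (l + m - 1) * (|(z - μ) / σ| ^ (l + m) + r ^ (l + m))) :=
        mul_le_mul_of_nonneg_left h3 (mul_nonneg (heatKernel_nonneg hs x y)
          (mul_nonneg (inv_nonneg.2 hv'.le) (hK _)))
      _ = _ := by simp only [hH]; ring
  have hM : 0 ≤ ∫ ζ, heatKernel 1 0 ζ * |ζ| ^ (l + m) :=
    integral_nonneg fun ζ => mul_nonneg (hK ζ) (by positivity)
  have hM0 : 0 ≤ ∫ ζ, heatKernel 1 0 ζ := integral_nonneg hK
  calc _ ≤ ∫ z, heatKernel (u + q) x y * σ⁻¹ * H ((z - μ) / σ) := by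
        refine integral_mono_of_nonneg (ae_of_all _ fun z => ?_)
          (((hHint.comp_div hv'.ne').comp_sub_right μ).const_mul _) (ae_of_all _ hle)
        exact mul_nonneg (mul_nonneg (heatKernel_nonneg hu _ _) (by positivity))
          (mul_nonneg (heatKernel_nonneg hq _ _) (by positivity))
    _ = heatKernel (u + q) x y * ∫ ζ, H ζ := by
        rw [MeasureTheory.integral_const_mul,
          integral_sub_right_eq_self (fun z => H (z / σ)) μ, Measure.integral_comp_div,
          abs_of_pos hv', smul_eq_mul]
        field_simp
    _ = heatKernel (u + q) x y * (2 ^ (l + m - 1) *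
          ((∫ ζ, heatKernel 1 0 ζ * |ζ| ^ (l + m)) + (∫ ζ, heatKernel 1 0 ζ) * r ^ (l + m))) := by
        simp only [hH]
        rw [MeasureTheory.integral_const_mul,
          MeasureTheory.integral_add hint (hint0.mul_const _), MeasureTheory.integral_mul_const]
    _ ≤ heatKernel (u + q) x y * (2 ^ (l + m - 1) *
          (((∫ ζ, heatKernel 1 0 ζ * |ζ| ^ (l + m)) + ∫ ζ, heatKernel 1 0 ζ) *
            (1 + r ^ (l + m)))) := by
        refine mul_le_mul_of_nonneg_left (mul_le_mul_of_nonneg_left ?_ (by positivity))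
          (heatKernel_nonneg hs x y)
        have := mul_nonneg hM (pow_nonneg hr0 (l + m))
        nlinarith
    _ = _ := by rw [bridgeMomentConst]; ring

theorem integral_rpow_neg_half_quarter {t : ℝ} (ht : 0 < t) :
    ∫ u in (0 : ℝ)..(t / 4), u ^ (-(1 : ℝ) / 2) = √t := by
  rw [integral_rpow (Or.inl (by norm_num)), show -(1 : ℝ) / 2 + 1 = 1 / 2 by norm_num,
    Real.zero_rpow (by norm_num), ← Real.sqrt_eq_rpow, Real.sqrt_div ht.le,
    show (4 : ℝ) = 2 ^ 2 by norm_num, Real.sqrt_sq (by norm_num)]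
  ring

/-- For all nonnegative integers `l, m` and every `c > 0` there is a
constant `C < ∞`, depending only on `l`, `m` and `c`, such that for all `0 < t ≤ c`,
all `0 ≤ w < t/4` and all `x, y ∈ ℝ`:
`∫₀^{t/4} u^{−1/2} ∫ g(u,x,z) (|z−x|/√u)^l g(t−w−u,z,y) (|y−z|/√(t−w−u))^m dz du
  ≤ C √t g(t−w,x,y) (1 + (|y−x|/√(t−w))^{l+m})`. -/
theorem heatKernel_convolution_bound (l m : ℕ) (c : ℝ) (hc : 0 < c) :
    ∃ C : ℝ, ∀ t : ℝ, 0 < t → t ≤ c → ∀ w : ℝ, 0 ≤ w → w < t / 4 → ∀ x y : ℝ,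
      (∫ u in (0 : ℝ)..(t / 4), u ^ (-(1 : ℝ) / 2) *
          ∫ z : ℝ, heatKernel u x z * (|z - x| / Real.sqrt u) ^ l *
            (heatKernel (t - w - u) z y * (|y - z| / Real.sqrt (t - w - u)) ^ m)) ≤
        C * Real.sqrt t * heatKernel (t - w) x y *
          (1 + (|y - x| / Real.sqrt (t - w)) ^ (l + m)) := by
  refine ⟨bridgeMomentConst (l + m), fun t ht _ w hw hwt x y => ?_⟩
  set B := bridgeMomentConst (l + m) * heatKernel (t - w) x y *
    (1 + (|y - x| / √(t - w)) ^ (l + m)) with hB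
  have hint : IntervalIntegrable (fun u : ℝ => u ^ (-(1 : ℝ) / 2)) volume 0 (t / 4) :=
    intervalIntegrable_rpow' (by norm_num)
  have key := integral_mono_of_nonneg (μ := volume.restrict (Set.Ioc 0 (t / 4)))
    (f := fun u : ℝ => u ^ (-(1 : ℝ) / 2) *
      ∫ z : ℝ, heatKernel u x z * (|z - x| / √u) ^ l *
        (heatKernel (t - w - u) z y * (|y - z| / √(t - w - u)) ^ m))
    (g := fun u : ℝ => u ^ (-(1 : ℝ) / 2) * B) ?_ (hint.1.mul_const B) ?_
  · rw [intervalIntegral.integral_of_le (by positivity)]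
    refine key.trans_eq ?_
    rw [MeasureTheory.integral_mul_const, ← intervalIntegral.integral_of_le (by positivity),
      integral_rpow_neg_half_quarter ht, hB]
    ring
  · filter_upwards [ae_restrict_mem measurableSet_Ioc] with u hu
    exact mul_nonneg (Real.rpow_nonneg hu.1.le _) (integral_nonneg fun z =>
      mul_nonneg (mul_nonneg (heatKernel_nonneg hu.1 _ _) (by positivity))
        (mul_nonneg (heatKernel_nonneg (by linarith [hu.2]) _ _) (by positivity)))
  · filter_upwards [ae_restrict_mem measurableSet_Ioc] with u hu
    have h := integral_heatKernel_mul_pow_le l m hu.1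
      (show 0 < t - w - u by linarith [hu.2]) x y
    rw [add_sub_cancel] at h
    exact mul_le_mul_of_nonneg_left h (Real.rpow_nonneg hu.1.le _)
end
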